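/- Let (S, f) and (T, g) be lifted partial permutations on k letters and let D be a domain from (S, f) to (T, g). Then for every a ∈ ℤ, D(a, a) = w_{q(a)}(S, f) − w_{q(a)}(T, g), where q(a) is the unique element of {1, …, m} with q(a) ≡ a + 1 (mod 2m − 2) or q(a) ≡ 1 − a (mod 2m − 2). -/

import Mathlib

open scoped Classical BigOperators

noncomputable section

/-- The group `G_m` of bijections of `ℤ` generated by the reflections
`x ↦ 1 - x` (about `1/2`) and `x ↦ 2m - 1 - x` (about `m - 1/2`). -/
def Gm (m : ℕ) : Subgroup (Equiv.Perm ℤ) :=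
  Subgroup.closure {Equiv.subLeft (1 : ℤ), Equiv.subLeft (2 * (m : ℤ) - 1)}

/-- `y` lies in the `G_m`-orbit of `x`. -/
def GmRel (m : ℕ) (x y : ℤ) : Prop := ∃ g ∈ Gm m, g x = y

/-- The `G_m`-orbit of an integer. -/
def GmOrbit (m : ℕ) (x : ℤ) : Set ℤ := {y | GmRel m x y}

/-- `(S, f)` is a lifted partial permutation on `k` letters: `S` is a
`G_m`-invariant subset of `ℤ`, `f` is `G_m`-equivariant on `S`, the quotient
`S/G_m` has exactly `k` elements, and the induced map `S/G_m → ℤ/G_m` is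
injective.  (The values of `f` off `S` are irrelevant.) -/
structure IsLPP (m k : ℕ) (S : Set ℤ) (f : ℤ → ℤ) : Prop where
  invariant : ∀ g ∈ Gm m, ∀ x ∈ S, g x ∈ S
  equivariant : ∀ g ∈ Gm m, ∀ x ∈ S, f (g x) = g (f x)
  orbits : (GmOrbit m '' S).ncard = k
  inj : ∀ x ∈ S, ∀ y ∈ S, GmRel m (f x) (f y) → GmRel m x y

/-- `(i, j)` is a crossing pair for `(S, f)`. -/
def IsCrossing (S : Set ℤ) (f : ℤ → ℤ) (i j : ℤ) : Prop :=
  i ∈ S ∧ j ∈ S ∧ i < j ∧ f j < f i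

/-- The `G_m`-orbit of the unordered pair `{p.1, p.2}`; two pairs are
equivalent exactly when they have the same `pairOrbit`. -/
def pairOrbit (m : ℕ) (p : ℤ × ℤ) : Set (Set ℤ) :=
  {A | ∃ g ∈ Gm m, A = {g p.1, g p.2}}

/-- The set of crossings of `(S, f)` (equivalence classes of crossing pairs). -/
def crossings (m : ℕ) (S : Set ℤ) (f : ℤ → ℤ) : Set (Set (Set ℤ)) :=
  pairOrbit m '' {p : ℤ × ℤ | IsCrossing S f p.1 p.2}

/-- The number of crossings `cross(f)`. -/
def crossCount (m : ℕ) (S : Set ℤ) (f : ℤ → ℤ) : ℕ := (crossings m S f).ncard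

/-- The set whose cardinality (halved) is the weight `w_j(S, f)`. -/
def weightSet (j : ℤ) (S : Set ℤ) (f : ℤ → ℤ) : Set ℤ :=
  {i | i ∈ S ∧ (((i : ℚ) < (j : ℚ) - 1/2 ∧ (j : ℚ) - 1/2 < (f i : ℚ)) ∨
    ((f i : ℚ) < (j : ℚ) - 1/2 ∧ (j : ℚ) - 1/2 < (i : ℚ)))}

/-- The weight `w_j(S, f)`. -/
def weight (j : ℤ) (S : Set ℤ) (f : ℤ → ℤ) : ℚ := (weightSet j S f).ncard / 2

/-- The resolution `f_{⟨i,j⟩}` of `f` at the crossing `⟨i, j⟩`. -/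
def resolveFun (m : ℕ) (f : ℤ → ℤ) (i j : ℤ) : ℤ → ℤ := fun x =>
  if h : ∃ g ∈ Gm m, g i = x then h.choose (f j)
  else if h' : ∃ g ∈ Gm m, g j = x then h'.choose (f i)
  else f x

/-- The graph `Γ_f = {(i, f i) : i ∈ S}`. -/
def graphOf (S : Set ℤ) (f : ℤ → ℤ) : Set (ℤ × ℤ) :=
  {p | p.1 ∈ S ∧ p.2 = f p.1}

/-- The `G_m`-orbit of a point of `ℤ × ℤ` under the diagonal action. -/
def GmOrbit2 (m : ℕ) (p : ℤ × ℤ) : Set (ℤ × ℤ) :=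
  {q | ∃ g ∈ Gm m, (g p.1, g p.2) = q}

/-- The left endpoint of the image of the unit interval `[a, a+1]` under the
affine extension of `g` to `ℝ`. -/
def sqIdx (g : Equiv.Perm ℤ) (a : ℤ) : ℤ := min (g a) (g (a + 1))

/-- The `G_m`-orbit of it the unit square indexed by `p`. -/
def sqOrbit (m : ℕ) (p : ℤ × ℤ) : Set (ℤ × ℤ) :=
  {q | ∃ g ∈ Gm m, (sqIdx g p.1, sqIdx g p.2) = q}

/-- `D` is a domain from `(S, f)` to `(T, g)`: a `G_m`-invariant assignment of
multiplicities to unit squares, nonzero on finitely many `G_m`-orbits of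
squares, whose corners are governed by the two graphs. -/
def IsHDomain (m : ℕ) (S : Set ℤ) (f : ℤ → ℤ) (T : Set ℤ) (g : ℤ → ℤ)
    (D : ℤ × ℤ → ℤ) : Prop :=
  (∀ γ ∈ Gm m, ∀ a b : ℤ, D (sqIdx γ a, sqIdx γ b) = D (a, b)) ∧
  (sqOrbit m '' {p : ℤ × ℤ | D p ≠ 0}).Finite ∧
  (∀ i j : ℤ,
    D (i, j) + D (i - 1, j - 1) - D (i, j - 1) - D (i - 1, j) =
      (if (i, j) ∈ graphOf T g then 1 else 0) -
        (if (i, j) ∈ graphOf S f then 1 else 0))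


/-- Elements of `G_m` are translations by multiples of `2m - 2` or reflections. -/
theorem exists_formula_of_mem_Gm {m : ℕ} {γ : Equiv.Perm ℤ} (hγ : γ ∈ Gm m) :
    ∃ t : ℤ, (∀ x, γ x = x + (2 * m - 2) * t) ∨ (∀ x, γ x = 1 - x + (2 * m - 2) * t) := by
  induction hγ using Subgroup.closure_induction with
  | mem x hx =>
    rcases hx with rfl | rfl
    · exact ⟨0, Or.inr fun x => by simp⟩
    · exact ⟨1, Or.inr fun x => by simp only [Equiv.subLeft_apply]; ring⟩
  | one => exact ⟨0, Or.inl fun x => by simp⟩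
  | mul x y _ _ hx hy =>
    obtain ⟨s, hs | hs⟩ := hx <;> obtain ⟨t, ht | ht⟩ := hy
    · exact ⟨s + t, Or.inl fun z => by rw [Equiv.Perm.mul_apply, ht, hs]; ring⟩
    · exact ⟨s + t, Or.inr fun z => by rw [Equiv.Perm.mul_apply, ht, hs]; ring⟩
    · exact ⟨s - t, Or.inr fun z => by rw [Equiv.Perm.mul_apply, ht, hs]; ring⟩
    · exact ⟨s - t, Or.inl fun z => by rw [Equiv.Perm.mul_apply, ht, hs]; ring⟩
  | inv x _ hx =>
    obtain ⟨s, hs | hs⟩ := hx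
    · exact ⟨-s, Or.inl fun z => by rw [Equiv.Perm.inv_eq_iff_eq, hs]; ring⟩
    · exact ⟨s, Or.inr fun z => by rw [Equiv.Perm.inv_eq_iff_eq, hs]; ring⟩

theorem subLeft_one_mem_Gm (m : ℕ) : Equiv.subLeft (1 : ℤ) ∈ Gm m :=
  Subgroup.subset_closure (Or.inl rfl)

theorem addRight_mem_Gm (m : ℕ) (t : ℤ) : Equiv.addRight ((2 * m - 2) * t : ℤ) ∈ Gm m := by
  have h : Equiv.addRight (2 * m - 2 : ℤ) ∈ Gm m := by
    have h' := (Gm m).mul_mem (Subgroup.subset_closure (Or.inr rfl)) (subLeft_one_mem_Gm m)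
    convert h' using 1
    ext x
    simp only [Equiv.coe_addRight, Equiv.Perm.mul_apply, Equiv.subLeft_apply]
    ring
  induction t using Int.induction_on with
  | zero =>
    convert (Gm m).one_mem using 1
    ext x
    simp
  | succ t ht =>
    convert (Gm m).mul_mem h ht using 1
    ext x
    simp only [Equiv.coe_addRight, Equiv.Perm.mul_apply]
    ring
  | pred t ht =>
    convert (Gm m).mul_mem ((Gm m).inv_mem h) ht using 1
    ext x
    rw [Equiv.Perm.mul_apply, Equiv.Perm.eq_inv_iff_eq]
    simp only [Equiv.coe_addRight]
    ring

theorem IsLPP.add_mem {m k : ℕ} {S : Set ℤ} {f : ℤ → ℤ} (hf : IsLPP m k S f) {x : ℤ}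
    (hx : x ∈ S) (t : ℤ) : x + (2 * m - 2) * t ∈ S :=
  hf.invariant _ (addRight_mem_Gm m t) x hx

theorem IsLPP.map_add {m k : ℕ} {S : Set ℤ} {f : ℤ → ℤ} (hf : IsLPP m k S f) {x : ℤ}
    (hx : x ∈ S) (t : ℤ) : f (x + (2 * m - 2) * t) = f x + (2 * m - 2) * t :=
  hf.equivariant _ (addRight_mem_Gm m t) x hx

/-- A lifted partial permutation has bounded displacement. -/
theorem IsLPP.exists_abs_sub_le {m k : ℕ} {S : Set ℤ} {f : ℤ → ℤ} (hm : 2 ≤ m)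
    (hf : IsLPP m k S f) : ∃ B : ℕ, ∀ x ∈ S, |f x - x| ≤ B := by
  have hn : (0 : ℤ) < 2 * m - 2 := by omega
  refine ⟨∑ r ∈ Finset.Ico (0 : ℤ) (2 * m - 2), (f r - r).natAbs, fun x hx => ?_⟩
  have hr : x % (2 * m - 2) = x + (2 * m - 2) * (-(x / (2 * m - 2))) := by
    rw [Int.emod_def]; ring
  have hfr := hf.map_add hx (-(x / (2 * m - 2)))
  rw [← hr] at hfr
  have hle := Finset.single_le_sum (f := fun r : ℤ => (f r - r).natAbs)
    (fun _ _ => Nat.zero_le _)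
    (Finset.mem_Ico.2 ⟨Int.emod_nonneg x hn.ne', Int.emod_lt_of_pos x hn⟩)
  have heq : f (x % (2 * m - 2)) - x % (2 * m - 2) = f x - x := by rw [hfr]; linarith
  simp only [heq] at hle
  rw [Int.abs_eq_natAbs]
  exact_mod_cast hle

/-- `G_m` preserves the distance of a unit square from the diagonal. -/
theorem abs_sqIdx_sub_sqIdx {m : ℕ} {γ : Equiv.Perm ℤ} (hγ : γ ∈ Gm m) (a b : ℤ) :
    |sqIdx γ a - sqIdx γ b| = |a - b| := by
  obtain ⟨t, h | h⟩ := exists_formula_of_mem_Gm hγ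
  · have hs (x : ℤ) : sqIdx γ x = x + (2 * m - 2) * t := by
      rw [sqIdx, h, h, min_eq_left (by linarith)]
    rw [hs, hs, add_sub_add_right_eq_sub]
  · have hs (x : ℤ) : sqIdx γ x = -x + (2 * m - 2) * t := by
      rw [sqIdx, h, h, min_eq_right (by linarith)]; ring
    rw [hs, hs, add_sub_add_right_eq_sub, neg_sub_neg, abs_sub_comm]

theorem mem_sqOrbit_self (m : ℕ) (p : ℤ × ℤ) : p ∈ sqOrbit m p := by
  refine ⟨1, (Gm m).one_mem, ?_⟩
  simp [sqIdx]

/-- A domain vanishes on the squares far from the diagonal. -/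
theorem IsHDomain.exists_eq_zero {m : ℕ} {S T : Set ℤ} {f g : ℤ → ℤ} {D : ℤ × ℤ → ℤ}
    (hD : IsHDomain m S f T g D) : ∃ B : ℕ, ∀ a b : ℤ, (B : ℤ) < |a - b| → D (a, b) = 0 := by
  obtain ⟨P, -, hPfin, hP⟩ := Set.Finite.exists_subset_finite_image_eq hD.2.1 subset_rfl
  refine ⟨∑ p ∈ hPfin.toFinset, (p.1 - p.2).natAbs, fun a b hab => ?_⟩
  by_contra h0
  obtain ⟨p, hp, hpab⟩ : sqOrbit m (a, b) ∈ sqOrbit m '' P := hP ▸ ⟨(a, b), h0, rfl⟩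
  obtain ⟨γ, hγ, he⟩ : (a, b) ∈ sqOrbit m p := hpab ▸ mem_sqOrbit_self m (a, b)
  obtain ⟨rfl, rfl⟩ := Prod.mk.inj he
  rw [abs_sqIdx_sub_sqIdx hγ, Int.abs_eq_natAbs, Nat.cast_lt] at hab
  exact hab.not_ge (Finset.single_le_sum (f := fun p : ℤ × ℤ => (p.1 - p.2).natAbs)
    (fun _ _ => Nat.zero_le _) (hPfin.mem_toFinset.2 hp))

/-- The mixed second differences of a function telescope over a rectangle. -/
theorem sum_range_mixed_difference (D : ℤ × ℤ → ℤ) (c d : ℤ) (M N : ℕ) :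
    ∑ p ∈ Finset.range M, ∑ q ∈ Finset.range N,
      (D (c + p + 1, d + q + 1) + D (c + p, d + q) - D (c + p + 1, d + q) - D (c + p, d + q + 1)) =
      D (c + M, d + N) + D (c, d) - D (c + M, d) - D (c, d + N) := by
  have h1 (p : ℕ) := Finset.sum_range_sub
    (fun q : ℕ => D (c + p + 1, d + q) - D (c + p, d + q)) N
  have h2 := Finset.sum_range_sub (fun p : ℕ => D (c + p, d + N) - D (c + p, d)) M
  push_cast [← add_assoc] at h1 h2
  calc _ = ∑ p ∈ Finset.range M, ((D (c + p + 1, d + N) - D (c + p + 1, d)) -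
        (D (c + p, d + N) - D (c + p, d))) := by
        refine Finset.sum_congr rfl fun p _ => ?_
        trans (D (c + p + 1, d + N) - D (c + p, d + N)) - (D (c + p + 1, d) - D (c + p, d))
        · rw [add_zero] at h1
          rw [← h1]
          exact Finset.sum_congr rfl fun q _ => by ring
        · ring
    _ = _ := by rw [h2, add_zero]; ring

/-- Counting the points of a graph in a rectangle. -/
theorem sum_range_indicator_graphOf (S : Set ℤ) (f : ℤ → ℤ) (c d : ℤ) (M N : ℕ) :
    ∑ p ∈ Finset.range M, ∑ q ∈ Finset.range N,
      (if ((c + p + 1, d + q + 1) : ℤ × ℤ) ∈ graphOf S f then (1 : ℤ) else 0) =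
      ({i | i ∈ S ∧ (c < i ∧ i ≤ c + M) ∧ d < f i ∧ f i ≤ d + N} : Set ℤ).ncard := by
  have hinner (p : ℕ) : ∑ q ∈ Finset.range N,
      (if ((c + p + 1, d + q + 1) : ℤ × ℤ) ∈ graphOf S f then (1 : ℤ) else 0) =
      if c + p + 1 ∈ S ∧ d < f (c + p + 1) ∧ f (c + p + 1) ≤ d + N then 1 else 0 := by
    split_ifs with h
    · obtain ⟨hS, h1, h2⟩ := h
      rw [Finset.sum_eq_single_of_mem (f (c + p + 1) - d - 1).toNat
        (Finset.mem_range.2 (by omega))]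
      · exact if_pos ⟨hS, by dsimp only; omega⟩
      · rintro q - hq
        refine if_neg fun hmem => hq ?_
        have := hmem.2
        dsimp only at this
        omega
    · refine Finset.sum_eq_zero fun q hq => if_neg fun hmem => h ?_
      have h2 := hmem.2
      have hq := Finset.mem_range.1 hq
      dsimp only at h2
      exact ⟨hmem.1, by omega, by omega⟩
  simp_rw [hinner]
  rw [Finset.sum_boole, ← Set.ncard_coe_finset, Nat.cast_inj,
    ← Set.ncard_image_of_injective (f := fun p : ℕ => c + p + 1) _
      (fun x y h => by dsimp only at h; omega)]
  congr 1
  ext i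
  simp only [Finset.coe_filter, Finset.mem_range, Set.mem_image, Set.mem_ofPred_eq]
  constructor
  · rintro ⟨p, ⟨hp, hS, hd⟩, rfl⟩
    exact ⟨hS, by omega, hd⟩
  · rintro ⟨hS, hi, hd⟩
    have hp : c + ((i - c - 1).toNat : ℤ) + 1 = i := by omega
    exact ⟨(i - c - 1).toNat, by rw [hp]; exact ⟨by omega, hS, hd⟩, hp⟩

/-- The corner values of a domain on a rectangle count the points of the two graphs inside it. -/
theorem IsHDomain.rectangle {m : ℕ} {S T : Set ℤ} {f g : ℤ → ℤ} {D : ℤ × ℤ → ℤ}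
    (hD : IsHDomain m S f T g D) (c d : ℤ) (M N : ℕ) :
    D (c + M, d + N) + D (c, d) - D (c + M, d) - D (c, d + N) =
      ({i | i ∈ T ∧ (c < i ∧ i ≤ c + M) ∧ d < g i ∧ g i ≤ d + N} : Set ℤ).ncard -
      ({i | i ∈ S ∧ (c < i ∧ i ≤ c + M) ∧ d < f i ∧ f i ≤ d + N} : Set ℤ).ncard := by
  rw [← sum_range_mixed_difference, ← sum_range_indicator_graphOf, ← sum_range_indicator_graphOf,
    ← Finset.sum_sub_distrib]
  refine Finset.sum_congr rfl fun p _ => ?_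
  rw [← Finset.sum_sub_distrib]
  refine Finset.sum_congr rfl fun q _ => ?_
  rw [← hD.2.2, add_sub_cancel_right, add_sub_cancel_right]

/-- The weight at `a + 1` splits into the graph points in two quadrants at `(a + 1/2, a + 1/2)`,
which may be truncated when the displacement of `f` is bounded. -/
theorem weight_add_one_eq {S : Set ℤ} {f : ℤ → ℤ} {B : ℕ} (hB : ∀ x ∈ S, |f x - x| ≤ B) (a : ℤ) :
    weight (a + 1) S f =
      ((({i | i ∈ S ∧ (a - B < i ∧ i ≤ a - B + B) ∧ a < f i ∧ f i ≤ a + B} : Set ℤ).ncard : ℚ) +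
      (({i | i ∈ S ∧ (a < i ∧ i ≤ a + B) ∧ a - B < f i ∧ f i ≤ a - B + B} : Set ℤ).ncard : ℚ))
        / 2 := by
  have hlt (i : ℤ) : (i : ℚ) < ((a + 1 : ℤ) : ℚ) - 1 / 2 ↔ i ≤ a := by
    constructor <;> intro h
    · have : (i : ℚ) < ((a + 1 : ℤ) : ℚ) := by linarith
      exact Int.lt_add_one_iff.1 (Int.cast_lt.1 this)
    · have : (i : ℚ) ≤ a := Int.cast_le.2 h
      push_cast
      linarith
  have hgt (i : ℤ) : ((a + 1 : ℤ) : ℚ) - 1 / 2 < i ↔ a < i := by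
    constructor <;> intro h
    · have : (a : ℚ) < i := by push_cast at h; linarith
      exact Int.cast_lt.1 this
    · have : ((a + 1 : ℤ) : ℚ) ≤ i := Int.cast_le.2 h
      linarith
  have hfin (c d e e' : ℤ) :
      ({i | i ∈ S ∧ (c < i ∧ i ≤ d) ∧ e < f i ∧ f i ≤ e'} : Set ℤ).Finite :=
    (Set.finite_Ioc c d).subset fun i hi => hi.2.1
  rw [weight, ← Nat.cast_add, ← Set.ncard_union_eq _ (hfin ..) (hfin ..)]
  · congr 3
    ext i
    simp only [weightSet, hlt, hgt, Set.mem_ofPred_eq, Set.mem_union]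
    constructor
    · rintro ⟨hi, h⟩
      have := abs_le.1 (hB i hi)
      rcases h with h | h
      · exact Or.inl ⟨hi, by omega, by omega⟩
      · exact Or.inr ⟨hi, by omega, by omega⟩
    · rintro (⟨hi, h⟩ | ⟨hi, h⟩)
      · exact ⟨hi, by omega⟩
      · exact ⟨hi, by omega⟩
  · exact Set.disjoint_left.2 fun i h h' => by
      have h1 := h.2.1.2
      have h2 := h'.2.1.1
      omega

/-- The diagonal multiplicity of a domain, without reducing modulo `G_m`. -/
theorem IsHDomain.diagonal_eq {m k : ℕ} (hm : 2 ≤ m) {S T : Set ℤ} {f g : ℤ → ℤ} {D : ℤ × ℤ → ℤ}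
    (hf : IsLPP m k S f) (hg : IsLPP m k T g) (hD : IsHDomain m S f T g D) (a : ℤ) :
    (D (a, a) : ℚ) = weight (a + 1) S f - weight (a + 1) T g := by
  obtain ⟨A, hA⟩ := hf.exists_abs_sub_le hm
  obtain ⟨B, hB⟩ := hg.exists_abs_sub_le hm
  obtain ⟨C, hC⟩ := hD.exists_eq_zero
  obtain ⟨K, hK⟩ : ∃ K : ℕ, K = A + B + C + 1 := ⟨_, rfl⟩
  have hfK (x : ℤ) (hx : x ∈ S) : |f x - x| ≤ K := (hA x hx).trans (by omega)
  have hgK (x : ℤ) (hx : x ∈ T) : |g x - x| ≤ K := (hB x hx).trans (by omega)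
  have hlow (x y : ℤ) (h : x + K ≤ y) : D (x, y) = 0 := hC x y (lt_abs.2 (by omega))
  have hhigh (x y : ℤ) (h : y + K ≤ x) : D (x, y) = 0 := hC x y (lt_abs.2 (by omega))
  have h1 := hD.rectangle (a - K) a K K
  have h2 := hD.rectangle a (a - K) K K
  rw [hlow (a - K) a (by omega), hlow (a - K) (a + K) (by omega),
    hlow (a - K + K) (a + K) (by omega)] at h1
  rw [hhigh a (a - K) (by omega), hhigh (a + K) (a - K) (by omega),
    hhigh (a + K) (a - K + K) (by omega)] at h2
  rw [sub_add_cancel a (K : ℤ)] at h1 h2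
  rw [weight_add_one_eq hfK, weight_add_one_eq hgK, sub_add_cancel]
  have h1' := congrArg (Int.cast : ℤ → ℚ) h1
  have h2' := congrArg (Int.cast : ℤ → ℚ) h2
  push_cast at h1' h2'
  linarith

/-- The multiplicity of a domain at the diagonal square
`[a, a+1] × [a, a+1]` (which contains the marked point `O_{q(a)}`) equals the
difference of the corresponding weights: `D(a, a) = w_{q(a)}(S, f) − w_{q(a)}(T, g)`,
where `q(a)` is the unique element of `{1, …, m}` congruent to `a + 1` or to
`1 − a` modulo `2m − 2`. -/
theorem domain_diagonal_multiplicity (m k : ℕ) (hm : 2 ≤ m) (hk0 : 0 < k) (hkm : k < m)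
    (S : Set ℤ) (f : ℤ → ℤ) (T : Set ℤ) (g : ℤ → ℤ)
    (hf : IsLPP m k S f) (hg : IsLPP m k T g)
    (D : ℤ × ℤ → ℤ) (hD : IsHDomain m S f T g D) :
    ∀ a j : ℤ, 1 ≤ j → j ≤ (m : ℤ) →
      (j ≡ a + 1 [ZMOD (2 * (m : ℤ) - 2)] ∨ j ≡ 1 - a [ZMOD (2 * (m : ℤ) - 2)]) →
      (D (a, a) : ℚ) = weight j S f - weight j T g := by
  intro a j _ _ hj
  have hdiag := hD.diagonal_eq hm hf hg (j - 1)
  rw [sub_add_cancel] at hdiag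
  rw [← hdiag, Int.cast_inj]
  rcases hj with h | h
  · obtain ⟨t, ht⟩ := h.dvd
    have hs := hD.1 _ (addRight_mem_Gm m t) (j - 1) (j - 1)
    have hi : sqIdx (Equiv.addRight ((2 * m - 2) * t : ℤ)) (j - 1) = a := by
      simp only [sqIdx, Equiv.coe_addRight, ← ht]
      omega
    rwa [hi] at hs
  · obtain ⟨t, ht⟩ := h.dvd
    have hs := hD.1 _ ((Gm m).mul_mem (subLeft_one_mem_Gm m) (addRight_mem_Gm m t)) (j - 1) (j - 1)
    have hi : sqIdx (Equiv.subLeft 1 * Equiv.addRight ((2 * m - 2) * t : ℤ)) (j - 1) = a := by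
      simp only [sqIdx, Equiv.Perm.mul_apply, Equiv.subLeft_apply, Equiv.coe_addRight, ← ht]
      omega
    rwa [hi] at hs
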